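/- arXiv:1509.03327 — 2 statements merged into one kernel-verified Lean document; each statement's English description precedes it below -/
import Mathlib

section
/- Suppose n, m, k ∈ ℕ satisfy 2^k + 1 ≤ n ≤ 2^{k+1} and m ≥ 2^k + 1 (Player 1 has the upper hand at level k; note that then n ≥ 2). Then the half-splitting bid b = ⌊n/2⌋ is optimal: p(n,m) = 1 − (⌊n/2⌋/n)·p(m, ⌊n/2⌋) − ((n − ⌊n/2⌋)/n)·p(m, n − ⌊n/2⌋), i.e., the maximum in the defining recurrence for p(n,m) is attained at b = ⌊n/2⌋. -/
/-- The line of slope `2 ^ k` touching, on `[2 ^ (k - 1), 2 ^ k]`, the convex piecewise linear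
function which describes the value of the game for the player in the weeds. -/
def weedsLine (k : ℕ) (x : ℚ) : ℚ := 2 ^ k * x - ((2 ^ k) ^ 2 + 2) / 3

/-- The value of the game, scaled by the product of the two numbers of candidates, for a player in
the weeds whose opponent has `b` candidates. -/
def weedsValue (b : ℕ) : ℚ := weedsLine (Nat.clog 2 b) b

theorem weedsLine_succ (k : ℕ) (x : ℚ) :
    weedsLine (k + 1) x = weedsLine k x + 2 ^ k * (x - 2 ^ k) := by
  unfold weedsLine
  ring

theorem weedsLine_add_weedsLine (k : ℕ) (x y : ℚ) :
    weedsLine k x + weedsLine k y = 2 * weedsLine k ((x + y) / 2) := by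
  unfold weedsLine
  ring

theorem weedsLine_le_of_le_pow {i j : ℕ} (hij : i ≤ j) {x : ℚ} (hx : x ≤ 2 ^ i) :
    weedsLine j x ≤ weedsLine i x := by
  induction j, hij using Nat.le_induction with
  | base => exact le_rfl
  | succ j hij ih =>
    have h : (2 : ℚ) ^ i ≤ 2 ^ j := pow_le_pow_right₀ (by norm_num) hij
    rw [weedsLine_succ]
    nlinarith [mul_nonneg (pow_nonneg (by norm_num : (0 : ℚ) ≤ 2) j) (sub_nonneg.2 (hx.trans h))]

theorem weedsLine_le_of_pow_le {i j : ℕ} (hij : i ≤ j) {x : ℚ} (hx : (2 : ℚ) ^ j ≤ 2 * x) :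
    weedsLine i x ≤ weedsLine j x := by
  induction j, hij using Nat.le_induction with
  | base => exact le_rfl
  | succ j hij ih =>
    rw [pow_succ] at hx
    have hpos : (0 : ℚ) < 2 ^ j := by positivity
    rw [weedsLine_succ]
    nlinarith [ih (by linarith), mul_nonneg hpos.le (by linarith : (0 : ℚ) ≤ x - 2 ^ j)]

theorem weedsLine_le_weedsValue (k : ℕ) {b : ℕ} (hb : 1 ≤ b) :
    weedsLine k b ≤ weedsValue b := by
  rcases le_total (Nat.clog 2 b) k with h | h
  · exact weedsLine_le_of_le_pow h (by exact_mod_cast Nat.le_pow_clog one_lt_two b)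
  · refine weedsLine_le_of_pow_le h ?_
    rcases hb.eq_or_lt with rfl | hb
    · norm_num
    · have h1 := Nat.pow_pred_clog_lt_self one_lt_two hb
      have h2 : 0 < Nat.clog 2 b := Nat.clog_pos one_lt_two hb
      obtain ⟨c, hc⟩ := Nat.exists_eq_succ_of_ne_zero h2.ne'
      rw [hc] at h1 ⊢
      have h3 : (2 : ℚ) ^ c < b := by exact_mod_cast h1
      rw [Nat.succ_eq_add_one, pow_succ]
      linarith

theorem weedsValue_eq_weedsLine {k b : ℕ} (hb : 1 ≤ b) (h1 : 2 ^ k ≤ 2 * b) (h2 : b ≤ 2 ^ k) :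
    weedsValue b = weedsLine k b :=
  le_antisymm (weedsLine_le_of_pow_le (Nat.clog_le_of_le_pow h2) (by exact_mod_cast h1))
    (weedsLine_le_weedsValue k hb)

theorem two_pow_le_two_mul_half {k n : ℕ} (h : 2 ^ k < n) : 2 ^ k ≤ 2 * (n / 2) := by
  rcases k with _ | k
  · norm_num at *
    omega
  · rw [pow_succ] at *
    omega

/-- The value of an upper hand position in terms of the line for the weeds. -/
theorem mul_sub_two_mul_weedsLine (k : ℕ) (m b : ℚ) :
    m * b - 2 * weedsLine k (m / 2) = weedsLine k (2 ^ k) + m * (b - 2 ^ k) + 2 := by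
  unfold weedsLine
  ring

theorem weedsLine_eq_add (k : ℕ) (b : ℚ) :
    weedsLine k b = weedsLine k (2 ^ k) + 2 ^ k * (b - 2 ^ k) := by
  unfold weedsLine
  ring

/-- The scaled form of the recurrence, as a criterion for evaluating the game. -/
theorem mul_value_eq_of_attained (p : ℕ → ℕ → ℚ)
    (hrec : ∀ n m : ℕ, ∀ hne : (Finset.Icc 1 (n - 1)).Nonempty, 2 ≤ m →
      p n m = (Finset.Icc 1 (n - 1)).sup' hne
        (fun b => 1 - (b : ℚ) / (n : ℚ) * p m b
          - ((n - b : ℕ) : ℚ) / (n : ℚ) * p m (n - b)))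
    {n m : ℕ} (hn : 2 ≤ n) (hm : 2 ≤ m) {v : ℚ}
    (hle : ∀ b c : ℕ, 1 ≤ b → 1 ≤ c → b + c = n →
      (n * m : ℚ) - m * b * p m b - m * c * p m c ≤ v)
    {b c : ℕ} (hb : 1 ≤ b) (hc : 1 ≤ c) (hbc : b + c = n)
    (hv : (n * m : ℚ) - m * b * p m b - m * c * p m c = v) :
    n * m * p n m = v := by
  have hn0 : (0 : ℚ) < n := by exact_mod_cast (by omega : 0 < n)
  have hm0 : (0 : ℚ) < m := by exact_mod_cast (by omega : 0 < m)
  have key : ∀ x y z w : ℚ, (n * m : ℚ) * (1 - x / n * y - z / n * w)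
      = n * m - m * x * y - m * z * w := by
    intro x y z w
    field_simp
  have hne : (Finset.Icc 1 (n - 1)).Nonempty := Finset.nonempty_Icc.2 (by omega)
  apply le_antisymm
  · rw [← le_div_iff₀' (by positivity), hrec n m hne hm]
    refine Finset.sup'_le _ _ fun x hx => ?_
    rw [Finset.mem_Icc] at hx
    rw [le_div_iff₀' (by positivity), key]
    exact hle x (n - x) hx.1 (by omega) (by omega)
  · rw [← hv, ← key, hrec n m hne hm]
    refine mul_le_mul_of_nonneg_left ?_ (by positivity)
    obtain rfl : c = n - b := by omega
    exact Finset.le_sup' (fun b : ℕ => 1 - (b : ℚ) / (n : ℚ) * p m b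
          - ((n - b : ℕ) : ℚ) / (n : ℚ) * p m (n - b)) (Finset.mem_Icc.2 ⟨hb, by omega⟩)

/-- Closed form of the value function. -/
theorem mul_value_eq (p : ℕ → ℕ → ℚ)
    (hp2 : ∀ n : ℕ, 2 ≤ n → p n 1 = 0)
    (hrec : ∀ n m : ℕ, ∀ hne : (Finset.Icc 1 (n - 1)).Nonempty, 2 ≤ m →
      p n m = (Finset.Icc 1 (n - 1)).sup' hne
        (fun b => 1 - (b : ℚ) / (n : ℚ) * p m b
          - ((n - b : ℕ) : ℚ) / (n : ℚ) * p m (n - b)))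
    (n m : ℕ) :
    (∀ k, 1 ≤ m → m ≤ 2 ^ k → 2 ^ k < n → n * m * p n m = weedsValue m) ∧
    (∀ k, 2 ^ k < n → n ≤ 2 ^ (k + 1) → 2 ^ k < m →
      n * m * p n m = n * m - 2 * weedsLine k (n / 2)) := by
  induction hs : n + m using Nat.strong_induction_on generalizing n m with
  | _ s ih =>
  subst hs
  constructor
  · intro l hm hml hln
    rcases hm.eq_or_lt with rfl | hm
    · have : 1 ≤ 2 ^ l := Nat.one_le_two_pow
      rw [hp2 n (by omega)]
      norm_num [weedsValue, weedsLine]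
    have hclog : 0 < Nat.clog 2 m := Nat.clog_pos one_lt_two hm
    obtain ⟨k, hk⟩ := Nat.exists_eq_succ_of_ne_zero hclog.ne'
    have hkm : 2 ^ k < m := by
      have := Nat.pow_pred_clog_lt_self one_lt_two hm
      rwa [hk] at this
    have hmk : m ≤ 2 ^ (k + 1) := by
      have := Nat.le_pow_clog one_lt_two m
      rwa [hk] at this
    have hkn : 2 ^ (k + 1) < n :=
      (Nat.pow_le_pow_right two_pos (hk.symm.le.trans (Nat.clog_le_of_le_pow hml))).trans_lt hln
    have hk1 : 1 ≤ 2 ^ k := Nat.one_le_two_pow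
    have hkm' : (2 : ℚ) ^ k < m := by exact_mod_cast hkm
    have hpow : (2 : ℕ) ^ (k + 1) = 2 ^ k + 2 ^ k := by ring
    have hvalue : weedsValue m =
        n * m - (2 * weedsLine k (2 ^ k) + m * (n - 2 * 2 ^ k) + 2) := by
      rw [weedsValue, hk]
      unfold weedsLine
      rw [Nat.succ_eq_add_one]
      ring
    have hupper : ∀ b, 2 ^ k < b → b < n →
        m * b * p m b = weedsLine k (2 ^ k) + m * (b - 2 ^ k) + 2 := fun b hb hbn => by
      rw [(ih (m + b) (by omega) m b rfl).2 k hkm hmk hb, mul_sub_two_mul_weedsLine]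
    have hweeds : ∀ b, 1 ≤ b → b ≤ 2 ^ k → m * b * p m b = weedsValue b := fun b hb hbk =>
      (ih (m + b) (by omega) m b rfl).1 k hb hbk hkm
    have hlower : ∀ b, 1 ≤ b → b ≤ 2 ^ k →
        weedsLine k (2 ^ k) + m * (b - 2 ^ k) ≤ m * b * p m b := fun b hb hbk => by
      have hbk' : (b : ℚ) ≤ 2 ^ k := by exact_mod_cast hbk
      rw [hweeds b hb hbk]
      refine le_trans ?_ (weedsLine_le_weedsValue k hb)
      rw [weedsLine_eq_add k b]
      nlinarith
    refine mul_value_eq_of_attained p hrec (by omega) (by omega) ?_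
      (b := 2 ^ k) (c := n - 2 ^ k) (by omega) (by omega) (by omega) ?_
    · intro b c hb hc hbc
      have hbc' : (b : ℚ) + c = n := by exact_mod_cast hbc
      rw [hvalue, ← hbc']
      rcases le_or_gt b (2 ^ k) with h | h
      · linarith [hlower b hb h, hupper c (by omega) (by omega)]
      rcases le_or_gt c (2 ^ k) with h' | h'
      · linarith [hlower c hc h', hupper b (by omega) (by omega)]
      · linarith [hupper b h (by omega), hupper c h' (by omega)]
    · rw [hvalue, hweeds _ hk1 le_rfl, hupper _ (by omega) (by omega),
        weedsValue_eq_weedsLine hk1 (by omega) le_rfl, Nat.cast_sub (by omega)]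
      push_cast
      ring
  · intro k hkn hnk hkm
    have hk1 : 1 ≤ 2 ^ k := Nat.one_le_two_pow
    have hkm' : (2 : ℚ) ^ k < m := by exact_mod_cast hkm
    have hpow : (2 : ℕ) ^ (k + 1) = 2 ^ k + 2 ^ k := by ring
    have hlower : ∀ b, 1 ≤ b → b < n → weedsLine k b ≤ m * b * p m b := fun b hb hbn => by
      have hI := ih (m + b) (by omega) m b rfl
      rcases le_or_gt b (2 ^ k) with h | h
      · rw [hI.1 k hb h hkm]
        exact weedsLine_le_weedsValue k hb
      rcases le_or_gt m (2 ^ (k + 1)) with h' | h'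
      · have hbk' : (2 : ℚ) ^ k < b := by exact_mod_cast h
        rw [hI.2 k hkm h' h, mul_sub_two_mul_weedsLine, weedsLine_eq_add k b]
        nlinarith
      · rw [hI.1 (k + 1) hb (by omega) h']
        exact weedsLine_le_weedsValue k hb
    have hhalf : ∀ b, 1 ≤ b → 2 ^ k ≤ 2 * b → b ≤ 2 ^ k → m * b * p m b = weedsLine k b :=
      fun b hb h1 h2 => by
        rw [(ih (m + b) (by omega) m b rfl).1 k hb h2 hkm, weedsValue_eq_weedsLine hb h1 h2]
    have hsum : ∀ b c : ℕ, b + c = n →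
        weedsLine k b + weedsLine k c = 2 * weedsLine k (n / 2) := fun b c hbc => by
      rw [weedsLine_add_weedsLine, ← hbc, Nat.cast_add]
    have hhalf_le := two_pow_le_two_mul_half hkn
    refine mul_value_eq_of_attained p hrec (by omega) (by omega) ?_
      (b := n / 2) (c := n - n / 2) (by omega) (by omega) (by omega) ?_
    · intro b c hb hc hbc
      linarith [hlower b hb (by omega), hlower c hc (by omega), hsum b c hbc]
    · rw [hhalf (n / 2) (by omega) hhalf_le (by omega),
        hhalf (n - n / 2) (by omega) (by omega) (by omega), sub_sub,
        hsum _ _ (by omega)]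

/-- In "Guess Who?", when Player 1 has the upper hand at level `k`
(`2^k + 1 ≤ n ≤ 2^(k+1)` and `m ≥ 2^k + 1`), the half-splitting bid
`b = ⌊n/2⌋` is optimal: the maximum in the defining recurrence for `p n m`
is attained at `b = ⌊n/2⌋`. -/
theorem guess_who_half_split_optimal_upper_hand
    (p : ℕ → ℕ → ℚ)
    (hp1 : ∀ m : ℕ, 2 ≤ m → p 1 m = 1)
    (hp2 : ∀ n : ℕ, 2 ≤ n → p n 1 = 0)
    (hrec : ∀ n m : ℕ, ∀ hn : 2 ≤ n, 2 ≤ m →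
      p n m = (Finset.Icc 1 (n - 1)).sup' (Finset.nonempty_Icc.mpr (by omega))
        (fun b => 1 - (b : ℚ) / (n : ℚ) * p m b
          - ((n - b : ℕ) : ℚ) / (n : ℚ) * p m (n - b)))
    (n m k : ℕ) (hn1 : 2 ^ k + 1 ≤ n) (hn2 : n ≤ 2 ^ (k + 1)) (hm : 2 ^ k + 1 ≤ m) :
    p n m = 1 - ((n / 2 : ℕ) : ℚ) / (n : ℚ) * p m (n / 2)
      - ((n - n / 2 : ℕ) : ℚ) / (n : ℚ) * p m (n - n / 2) := by
  have hk1 : 1 ≤ 2 ^ k := Nat.one_le_two_pow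
  have hpow : (2 : ℕ) ^ (k + 1) = 2 ^ k + 2 ^ k := by ring
  have hn0 : (0 : ℚ) < n := by exact_mod_cast (by omega : 0 < n)
  have hm0 : (0 : ℚ) < m := by exact_mod_cast (by omega : 0 < m)
  have hhalf_le := two_pow_le_two_mul_half hn1
  have hclosed := mul_value_eq p hp2 fun n m hne hm =>
    hrec n m (by have := Finset.nonempty_Icc.1 hne; omega) hm
  have hvalue := (hclosed n m).2 k hn1 hn2 hm
  have hhalf : ∀ b, 1 ≤ b → 2 ^ k ≤ 2 * b → b ≤ 2 ^ k → m * b * p m b = weedsLine k b :=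
    fun b hb h1 h2 => by
      rw [(hclosed m b).1 k hb h2 hm, weedsValue_eq_weedsLine hb h1 h2]
  have hsum : weedsLine k (n / 2 : ℕ) + weedsLine k (n - n / 2 : ℕ)
      = 2 * weedsLine k (n / 2) := by
    rw [weedsLine_add_weedsLine, ← Nat.cast_add, Nat.add_sub_cancel' (Nat.div_le_self n 2)]
  rw [← hsum, ← hhalf (n / 2) (by omega) hhalf_le (by omega),
    ← hhalf (n - n / 2) (by omega) (by omega) (by omega)] at hvalue
  refine mul_left_cancel₀ (mul_pos hn0 hm0).ne' (hvalue.trans ?_)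
  field_simp
  ring
end

section
/- Suppose n, m, k ∈ ℕ satisfy n > 2^{k+1} and 2^k < m ≤ 2^{k+1} (Player 1 is in the weeds at level k). Then for every b ∈ ℕ with 1 ≤ b ≤ n−1, one has 1 − (b/n)·q(m,b) − ((n−b)/n)·q(m,n−b) ≤ q_{W_k}(n,m), and equality holds when b = 2^k. Consequently q_{W_k}(n,m) = max_{b ∈ {1,…,n−1}} (1 − (b/n)·q(m,b) − ((n−b)/n)·q(m,n−b)). -/
/-- The candidate value function when Player 1 is in the weeds at level `k`. -/
def qW (k n m : ℕ) : ℚ :=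
  2 ^ (k + 1) / (n : ℚ) - 2 / 3 * (2 ^ (2 * k + 1) + 1) / ((m : ℚ) * (n : ℚ))

/-- The candidate value function when Player 1 has the upper hand at level `k`. -/
def qU (k n m : ℕ) : ℚ :=
  1 - 2 ^ k / (m : ℚ) + 2 / 3 * (2 ^ (2 * k) + 2) / ((m : ℚ) * (n : ℚ))

/-- The candidate value function `q` for "Guess Who?": `q 1 m = 1` (for `m ≥ 2`),
`q n 1 = 0` (for `n ≥ 2`); for `n, m ≥ 2`, with `k = ⌊log₂ (m-1)⌋` (so that
`2^k < m ≤ 2^(k+1)`), `q n m = qW k n m` if `n > 2^(k+1)` (in the weeds at level `k`),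
and otherwise `q n m = qU k' n m` with `k' = ⌊log₂ (n-1)⌋` (so `2^k' < n ≤ 2^(k'+1)`
and `2^k' < m`: the upper hand at level `k'`). -/
def q (n m : ℕ) : ℚ :=
  if n ≤ 1 then 1
  else if m ≤ 1 then 0
  else if 2 ^ (Nat.log 2 (m - 1) + 1) < n then qW (Nat.log 2 (m - 1)) n m
  else qU (Nat.log 2 (n - 1)) n m

/-- For an opponent pool of size `c ≤ 2 ^ k < m`, the value `c * q m c` has a closed form at the
level `i` with `c ≤ 2 ^ i`. -/
theorem exists_mul_q_eq_of_le_two_pow {m k c : ℕ} (hm : 2 ^ k < m) (hc : 1 ≤ c)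
    (hck : c ≤ 2 ^ k) :
    ∃ i ≤ k, c ≤ 2 ^ i ∧
      (c : ℚ) * q m c = ((c : ℚ) * 2 ^ i - (2 ^ i) ^ 2 / 3 - 2 / 3) / m := by
  have hm2 : ¬ m ≤ 1 := by
    have := Nat.one_le_two_pow (n := k)
    omega
  rcases hc.eq_or_lt with rfl | hc
  · exact ⟨0, Nat.zero_le k, by simp, by norm_num [q, hm2]⟩
  have hlog : Nat.log 2 (c - 1) < k := Nat.log_lt_of_lt_pow (by omega) (by omega)
  have hclt : c - 1 < 2 ^ (Nat.log 2 (c - 1) + 1) := Nat.lt_pow_succ_log_self one_lt_two _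
  have hle : 2 ^ (Nat.log 2 (c - 1) + 1) ≤ 2 ^ k := Nat.pow_le_pow_right two_pos hlog
  refine ⟨Nat.log 2 (c - 1) + 1, hlog, by omega, ?_⟩
  rw [q, if_neg hm2, if_neg (by omega), if_pos (by omega), qW]
  have hc0 : (c : ℚ) ≠ 0 := by norm_cast; omega
  have hm0 : (m : ℚ) ≠ 0 := by norm_cast; omega
  field_simp
  ring

/-- For an opponent pool of size `c > 2 ^ k`, a player with `2 ^ k < m ≤ 2 ^ (k + 1)` has the
upper hand at level `k`. -/
theorem mul_q_eq_of_two_pow_lt {m k c : ℕ} (hm1 : 2 ^ k < m) (hm2 : m ≤ 2 ^ (k + 1))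
    (hck : 2 ^ k < c) :
    (c : ℚ) * q m c = c - 2 ^ k + 2 / 3 * ((2 ^ k) ^ 2 + 2) / m := by
  have hpos := Nat.one_le_two_pow (n := k)
  have hlog : Nat.log 2 (m - 1) = k :=
    Nat.log_eq_of_pow_le_of_lt_pow (by omega) (by omega)
  have hlogc : k ≤ Nat.log 2 (c - 1) := Nat.le_log_of_pow_le one_lt_two (by omega)
  have hle : 2 ^ (k + 1) ≤ 2 ^ (Nat.log 2 (c - 1) + 1) :=
    Nat.pow_le_pow_right two_pos (by omega)
  rw [q, if_neg (by omega), if_neg (by omega), if_neg (by omega), hlog, qU]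
  have hc0 : (c : ℚ) ≠ 0 := by norm_cast; omega
  have hm0 : (m : ℚ) ≠ 0 := by norm_cast; omega
  field_simp
  ring

theorem two_pow_mul_q {m k : ℕ} (hm : 2 ^ k < m) :
    (2 ^ k : ℚ) * q m (2 ^ k) = 2 / 3 * ((2 ^ k) ^ 2 - 1) / m := by
  obtain ⟨i, hik, hi, h⟩ := exists_mul_q_eq_of_le_two_pow hm Nat.one_le_two_pow le_rfl
  obtain rfl : i = k := le_antisymm hik ((Nat.pow_le_pow_iff_right one_lt_two).1 hi)
  push_cast at h
  rw [h]
  ring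

theorem le_mul_q_of_le_two_pow {m k c : ℕ} (hm : 2 ^ k < m) (hc : 1 ≤ c) (hck : c ≤ 2 ^ k) :
    2 / 3 * ((2 ^ k) ^ 2 - 1) / (m : ℚ) - (2 ^ k - c) ≤ c * q m c := by
  obtain ⟨i, hik, hi, h⟩ := exists_mul_q_eq_of_le_two_pow hm hc hck
  have hm0 : (0 : ℚ) < m := by norm_cast; omega
  have hmq : (2 ^ k : ℚ) < m := by exact_mod_cast hm
  have hckq : (c : ℚ) ≤ 2 ^ k := by exact_mod_cast hck
  have hiq : (c : ℚ) ≤ 2 ^ i := by exact_mod_cast hi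
  rw [h, sub_le_iff_le_add, ← sub_le_iff_le_add', ← sub_div, div_le_iff₀ hm0]
  have hmul := mul_le_mul_of_nonneg_left hmq.le (sub_nonneg.2 hckq)
  rcases hik.eq_or_lt with rfl | hik
  · nlinarith
  · have hdouble : 2 * (2 ^ i : ℚ) ≤ 2 ^ k := by
      rw [← pow_succ']
      exact pow_le_pow_right₀ one_le_two hik
    have hi0 : (0 : ℚ) < 2 ^ i := by positivity
    have hprod : (0 : ℚ) ≤ (2 ^ k - 2 ^ i) * ((2 ^ k + 2 ^ i) / 3 - c) :=
      mul_nonneg (by linarith) (by linarith)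
    nlinarith

/-- The total value to the opponent after a bid splits the pool as `b + c` is smallest at
the bold bid. -/
theorem le_mul_q_add_mul_q {m k b c : ℕ} (hm1 : 2 ^ k < m) (hm2 : m ≤ 2 ^ (k + 1))
    (hb : 1 ≤ b) (hc : 1 ≤ c) (hbc : 2 ^ (k + 1) < b + c) :
    (b : ℚ) + c - 2 * 2 ^ k + 2 / 3 * (2 * (2 ^ k) ^ 2 + 1) / m ≤ b * q m b + c * q m c := by
  wlog hle : b ≤ c generalizing b c
  · have := this hc hb (by omega) (by omega)
    linarith
  have hck : 2 ^ k < c := by rw [pow_succ] at hbc; omega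
  rw [mul_q_eq_of_two_pow_lt hm1 hm2 hck]
  have hm0 : (0 : ℚ) < m := by norm_cast; omega
  rcases le_or_gt b (2 ^ k) with hbk | hbk
  · have := le_mul_q_of_le_two_pow hm1 hb hbk
    have hsum : 2 / 3 * (2 * (2 ^ k) ^ 2 + 1) / (m : ℚ) =
        2 / 3 * ((2 ^ k) ^ 2 - 1) / m + 2 / 3 * ((2 ^ k) ^ 2 + 2) / m := by ring
    linarith
  · rw [mul_q_eq_of_two_pow_lt hm1 hm2 hbk]
    have hsum : 2 / 3 * (2 * (2 ^ k) ^ 2 + 1) / (m : ℚ) + 2 / m =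
        2 / 3 * ((2 ^ k) ^ 2 + 2) / m + 2 / 3 * ((2 ^ k) ^ 2 + 2) / m := by ring
    have : 0 < 2 / (m : ℚ) := by positivity
    linarith

theorem qW_eq_one_sub_div {k n m : ℕ} (hn : n ≠ 0) :
    qW k n m = 1 - (n - 2 * 2 ^ k + 2 / 3 * (2 * (2 ^ k) ^ 2 + 1) / (m : ℚ)) / n := by
  have hn0 : (n : ℚ) ≠ 0 := by exact_mod_cast hn
  rw [qW, mul_comm (m : ℚ), ← div_div, div_right_comm]
  field_simp
  ring

/-- The weeds lemma: if Player 1 is in the weeds at level `k`, then every bid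
`1 ≤ b ≤ n - 1` yields payoff at most `qW k n m`, with equality at the bold bid
`b = 2^k`; consequently `qW k n m` is the maximum over all bids. -/
theorem q_weeds_recurrence
    (n m k : ℕ) (hn : 2 ^ (k + 1) < n) (hm1 : 2 ^ k < m) (hm2 : m ≤ 2 ^ (k + 1)) :
    (∀ b : ℕ, 1 ≤ b → b ≤ n - 1 →
      1 - (b : ℚ) / (n : ℚ) * q m b - ((n - b : ℕ) : ℚ) / (n : ℚ) * q m (n - b)
        ≤ qW k n m) ∧
    (1 - ((2 ^ k : ℕ) : ℚ) / (n : ℚ) * q m (2 ^ k)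
      - ((n - 2 ^ k : ℕ) : ℚ) / (n : ℚ) * q m (n - 2 ^ k) = qW k n m) ∧
    IsGreatest
      ((fun b : ℕ =>
        1 - (b : ℚ) / (n : ℚ) * q m b - ((n - b : ℕ) : ℚ) / (n : ℚ) * q m (n - b)) ''
        (Set.Icc 1 (n - 1)))
      (qW k n m) := by
  have hn0 : n ≠ 0 := by omega
  have hpos := Nat.one_le_two_pow (n := k)
  have hsucc : 2 ^ (k + 1) = 2 * 2 ^ k := pow_succ' 2 k
  have payoff_eq (x y u v : ℚ) :
      1 - x / n * u - y / n * v = 1 - (x * u + y * v) / n := by ring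
  have hle : ∀ b : ℕ, 1 ≤ b → b ≤ n - 1 →
      1 - (b : ℚ) / (n : ℚ) * q m b - ((n - b : ℕ) : ℚ) / (n : ℚ) * q m (n - b)
        ≤ qW k n m := by
    intro b hb hbn
    have h := le_mul_q_add_mul_q (c := n - b) hm1 hm2 hb (by omega) (by omega)
    have hsum : (b : ℚ) + (n - b : ℕ) = n := by
      rw [← Nat.cast_add]
      congr 1
      omega
    rw [hsum] at h
    rw [payoff_eq, qW_eq_one_sub_div hn0]
    gcongr
  have heq : 1 - ((2 ^ k : ℕ) : ℚ) / (n : ℚ) * q m (2 ^ k)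
      - ((n - 2 ^ k : ℕ) : ℚ) / (n : ℚ) * q m (n - 2 ^ k) = qW k n m := by
    rw [payoff_eq, qW_eq_one_sub_div hn0,
      mul_q_eq_of_two_pow_lt (c := n - 2 ^ k) hm1 hm2 (by omega),
      Nat.cast_sub (by omega)]
    push_cast
    rw [two_pow_mul_q hm1]
    ring
  refine ⟨hle, heq, ⟨2 ^ k, ⟨hpos, by omega⟩, heq⟩, ?_⟩
  rintro _ ⟨b, ⟨hb, hbn⟩, rfl⟩
  exact hle b hb hbn
end
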